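/- Let X be a compact topological space, μ a finite Borel measure on X with full support, and s : X → ℝ a continuous function whose maximum k₀ = max_X s is positive. Then there exists a continuous function g : X → ℝ with g ≥ 1 everywhere such that ∫_X g s dμ > 0; moreover g can be chosen to be identically 1 on the set where s < k₀/4 and constant equal to some value M > 1 on the set where s ≥ k₀/2. -/

import Mathlib

open MeasureTheory

/-- **The analytic selection lemma.** Let `X` be a compact topological space, `μ` a finite
Borel measure on `X` with full support, and `s : X → ℝ` a continuous function whose
maximum `k₀ = max_X s` is positive. Then there is a continuous `g : X → ℝ` with `g ≥ 1`
everywhere such that `∫_X g s dμ > 0`; moreover `g` can be chosen identically `1` on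
`{s < k₀/4}` and constant equal to some value `M > 1` on `{s ≥ k₀/2}`. -/
theorem exists_weight_positive_integral {X : Type*} [TopologicalSpace X] [CompactSpace X]
    [MeasurableSpace X] [BorelSpace X] (μ : Measure X) [IsFiniteMeasure μ]
    (hfull : ∀ U : Set X, IsOpen U → U.Nonempty → 0 < μ U)
    (s : X → ℝ) (hs : Continuous s) (k₀ : ℝ) (hk₀ : IsGreatest (Set.range s) k₀)
    (hpos : 0 < k₀) :
    ∃ g : X → ℝ, Continuous g ∧ (∀ x, 1 ≤ g x) ∧
      (0 < ∫ x, g x * s x ∂μ) ∧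
      ∃ M : ℝ, 1 < M ∧ (∀ x, s x < k₀ / 4 → g x = 1) ∧
        ∀ x, k₀ / 2 ≤ s x → g x = M := by
  have : μ.IsOpenPosMeasure := ⟨fun U hU hne => (hfull U hU hne).ne'⟩
  obtain ⟨⟨x₀, hx₀⟩, -⟩ := hk₀
  have integrable_of_continuous (f : X → ℝ) (hf : Continuous f) : Integrable f μ :=
    hf.integrable_of_hasCompactSupport (HasCompactSupport.of_compactSpace f)
  -- a cutoff vanishing for `s ≤ k₀ / 4` and equal to `1` for `k₀ / 2 ≤ s`
  set φ : X → ℝ := fun x => min 1 (max 0 ((s x - k₀ / 4) / (k₀ / 4))) with hφ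
  have hφ_cont : Continuous φ := by fun_prop
  have hφ_nonneg (x : X) : 0 ≤ φ x := le_min zero_le_one (le_max_left _ _)
  have hφ_low (x : X) (hx : s x ≤ k₀ / 4) : φ x = 0 := by
    have : (s x - k₀ / 4) / (k₀ / 4) ≤ 0 :=
      div_nonpos_of_nonpos_of_nonneg (by linarith) (by linarith)
    simp [hφ, max_eq_left this]
  have hφ_high (x : X) (hx : k₀ / 2 ≤ s x) : φ x = 1 :=
    min_eq_left (le_max_of_le_right ((one_le_div (by linarith)).2 (by linarith)))
  have hφs_cont : Continuous fun x => φ x * s x := hφ_cont.mul hs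
  have hB : 0 < ∫ x, φ x * s x ∂μ := by
    refine hφs_cont.integral_pos_of_hasCompactSupport_nonneg_nonzero
      (HasCompactSupport.of_compactSpace _) (fun x => ?_) (x := x₀) ?_
    · rcases le_total (s x) (k₀ / 4) with hx | hx
      · simp [hφ_low x hx]
      · exact mul_nonneg (hφ_nonneg x) (by linarith)
    · rw [hφ_high x₀ (by linarith), hx₀, one_mul]
      exact hpos.ne'
  set A := ∫ x, s x ∂μ
  set B := ∫ x, φ x * s x ∂μ
  set T := (|A| + 1) / B
  have hT : 0 < T := by positivity
  refine ⟨fun x => 1 + T * φ x, by fun_prop, fun x => ?_, ?_, 1 + T, by linarith,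
    fun x hx => by simp [hφ_low x hx.le], fun x hx => by simp [hφ_high x hx]⟩
  · have := mul_nonneg hT.le (hφ_nonneg x)
    linarith
  · have hsplit : ∫ x, (1 + T * φ x) * s x ∂μ = A + T * B := by
      simp_rw [add_mul, one_mul, mul_assoc]
      rw [integral_add (integrable_of_continuous _ hs)
        ((integrable_of_continuous _ hφs_cont).const_mul T), integral_const_mul]
    rw [hsplit, div_mul_cancel₀ _ hB.ne']
    linarith [neg_abs_le A]
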